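/- Let E₁, E₂ ∈ (𝓜, c_k, n_k, κ) and let f(x,y) = x + s·y with s ≠ 0. If sup_{k≥1}(1 − ξ_k) ≤ |s| ≤ inf_{k≥1}( c_k/(1 − ξ_k) ), then f(E₁, E₂) = {x + s·y : x ∈ E₁, y ∈ E₂} is a closed interval. -/

import Mathlib

/-- The common length `c₁ ⋯ c_k` of the level-`k` basic intervals. -/
noncomputable def moranLen (c : ℕ → ℝ) (k : ℕ) : ℝ := ∏ j ∈ Finset.range k, c (j + 1)

/-- A word `w = (i₁, …, i_k)` is admissible if `i_j < n j` for all `j`. -/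
def MoranAdm (n : ℕ → ℕ) (w : List ℕ) : Prop := ∀ i < w.length, w.getD i 0 < n (i + 1)

/-- The union `C_k` of all level-`k` basic intervals, where `L w` is the left endpoint of
the basic interval coded by the word `w`. -/
def moranLevel (c : ℕ → ℝ) (n : ℕ → ℕ) (L : List ℕ → ℝ) (k : ℕ) : Set ℝ :=
  ⋃ w ∈ {w : List ℕ | MoranAdm n w ∧ w.length = k}, Set.Icc (L w) (L w + moranLen c k)

/-- `E` is a homogeneous Moran set of the class `(𝓜, c_k, n_k, κ)`, witnessed by the
left-endpoint function `L` of its basic intervals. -/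
def IsMoran (c : ℕ → ℝ) (n : ℕ → ℕ) (κ : ℝ) (L : List ℕ → ℝ) (E : Set ℝ) : Prop :=
  L [] = 0 ∧
  (∀ w : List ℕ, MoranAdm n w →
    (∀ i j : ℕ, i < j → j < n (w.length + 1) →
      L (w ++ [i]) ≤ L (w ++ [j]) ∧
      L (w ++ [i]) + moranLen c (w.length + 1) - L (w ++ [j]) ≤
        κ * moranLen c (w.length + 1)) ∧
    L (w ++ [0]) = L w ∧
    L (w ++ [n (w.length + 1) - 1]) + moranLen c (w.length + 1) =
      L w + moranLen c w.length ∧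
    (⋃ i ∈ Finset.range (n (w.length + 1)),
        Set.Icc (L (w ++ [i])) (L (w ++ [i]) + moranLen c (w.length + 1)))
      ⊂ Set.Icc (L w) (L w + moranLen c w.length)) ∧
  E = ⋂ k, moranLevel c n L k

/-- `ξ_k = c_k (2 + (n_k − 2)(1 − κ))`. -/
noncomputable def xiM (c : ℕ → ℝ) (n : ℕ → ℕ) (κ : ℝ) (k : ℕ) : ℝ :=
  c k * (2 + ((n k : ℝ) - 2) * (1 - κ))

lemma hit_aux (p : ℕ → ℝ) (d u v : ℝ) (m : ℕ)
    (hstep : ∀ i < m, p (i + 1) ≤ p i + d + (v - u)) (h0 : p 0 ≤ v) (hm : u ≤ p m + d) :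
    ∃ i ≤ m, p i ≤ v ∧ u ≤ p i + d := by
  induction m with
  | zero => exact ⟨0, le_rfl, h0, hm⟩
  | succ m ih =>
    by_cases h : p (m + 1) ≤ v
    · exact ⟨m + 1, le_rfl, h, hm⟩
    · have h1 := hstep m (by omega)
      obtain ⟨i, hi, h2⟩ := ih (fun i hi => hstep i (by omega)) (by linarith)
      exact ⟨i, by omega, h2⟩

lemma growth_aux (p : ℕ → ℝ) (e : ℝ) (N : ℕ)
    (h : ∀ i, i + 1 < N → p i + e ≤ p (i + 1)) (a b : ℕ) (hb : a + b < N) :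
    p a + b * e ≤ p (a + b) := by
  induction b with
  | zero => simp
  | succ b ih =>
    have h1 := ih (by omega)
    have h2 := h (a + b) (by omega)
    push_cast
    rw [← add_assoc]
    linarith

lemma len_pos (c : ℕ → ℝ) (hc : ∀ k ≥ 1, 0 < c k ∧ c k < 1 / 2) (k : ℕ) :
    0 < moranLen c k := Finset.prod_pos fun j _ => (hc (j + 1) (by omega)).1

lemma len_succ (c : ℕ → ℝ) (k : ℕ) : moranLen c (k + 1) = moranLen c k * c (k + 1) := by
  simp [moranLen, Finset.prod_range_succ]

lemma len_le (c : ℕ → ℝ) (hc : ∀ k ≥ 1, 0 < c k ∧ c k < 1 / 2) (k : ℕ) :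
    moranLen c k ≤ (1 / 2) ^ k := by
  induction k with
  | zero => simp [moranLen]
  | succ k ih =>
    rw [len_succ, pow_succ]
    have := hc (k + 1) (by omega)
    exact mul_le_mul ih this.2.le this.1.le (by positivity)

lemma adm_append (n : ℕ → ℕ) (w : List ℕ) (i : ℕ) (hw : MoranAdm n w)
    (hi : i < n (w.length + 1)) : MoranAdm n (w ++ [i]) := by
  intro j hj
  simp only [List.length_append, List.length_singleton] at hj
  rcases Nat.lt_succ_iff_lt_or_eq.mp hj with h | h
  · rw [List.getD_append _ _ _ _ h]
    exact hw j h
  · subst h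
    simpa using hi

/-- Consecutive children are at distance at most `ℓ (1 - ξ)`. -/
lemma step_bound (c : ℕ → ℝ) (n : ℕ → ℕ) (κ : ℝ) (hn : ∀ k ≥ 1, 2 ≤ n k)
    (L : List ℕ → ℝ) (E : Set ℝ) (hE : IsMoran c n κ L E) (w : List ℕ) (hw : MoranAdm n w)
    (i : ℕ) (hi : i < n (w.length + 1) - 1) :
    L (w ++ [i + 1]) ≤ L (w ++ [i]) + moranLen c (w.length + 1)
      + moranLen c w.length * (1 - xiM c n κ (w.length + 1)) := by
  obtain ⟨-, h, -⟩ := hE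
  obtain ⟨h1, h2, h3, -⟩ := h w hw
  have hn' := hn (w.length + 1) (by omega)
  have hg : ∀ i, i + 1 < n (w.length + 1) →
      L (w ++ [i]) + (1 - κ) * moranLen c (w.length + 1) ≤ L (w ++ [i + 1]) := by
    intro i hi
    have := (h1 i (i + 1) (by omega) hi).2
    linarith
  have g1 := growth_aux (fun i => L (w ++ [i])) _ _ hg 0 i (by omega)
  obtain ⟨b, hb⟩ : ∃ b, n (w.length + 1) = i + 1 + b + 1 :=
    ⟨n (w.length + 1) - 2 - i, by omega⟩
  have g2 := growth_aux (fun i => L (w ++ [i])) _ _ hg (i + 1) b (by omega)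
  simp only [zero_add] at g1
  have e : n (w.length + 1) - 1 = i + 1 + b := by omega
  rw [e] at h3
  have hx : moranLen c w.length * (1 - xiM c n κ (w.length + 1)) =
      moranLen c w.length - moranLen c (w.length + 1) * (2 + ((i : ℝ) + b) * (1 - κ)) := by
    rw [xiM, hb, len_succ]; push_cast; ring
  rw [hx]
  nlinarith

lemma hit_child (c : ℕ → ℝ) (n : ℕ → ℕ) (κ : ℝ) (hn : ∀ k ≥ 1, 2 ≤ n k)
    (L : List ℕ → ℝ) (E : Set ℝ) (hE : IsMoran c n κ L E) (w : List ℕ) (hw : MoranAdm n w)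
    (u v x : ℝ) (hux : u ≤ x) (hxv : x ≤ v) (hx : x ∈ Set.Icc (L w) (L w + moranLen c w.length))
    (hc0 : 0 < moranLen c (w.length + 1))
    (hlen : moranLen c w.length * (1 - xiM c n κ (w.length + 1)) ≤ v - u) :
    ∃ i < n (w.length + 1), ∃ x' ∈ Set.Icc (L (w ++ [i])) (L (w ++ [i]) +
      moranLen c (w.length + 1)), u ≤ x' ∧ x' ≤ v := by
  have hn' := hn (w.length + 1) (by omega)
  obtain ⟨h1, h2, h3, -⟩ := hE.2.1 w hw
  obtain ⟨i, hi, ha, hb⟩ := hit_aux (fun i => L (w ++ [i])) (moranLen c (w.length + 1)) u v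
    (n (w.length + 1) - 1)
    (fun i hi => by have := step_bound c n κ hn L E hE w hw i hi; linarith)
    (by simp only [h2]; linarith [hx.1]) (by simp only [h3]; linarith [hx.2])
  refine ⟨i, by omega, max u (L (w ++ [i])), ⟨le_max_right _ _, max_le hb (by linarith)⟩,
    le_max_left _ _, max_le (by linarith) ha⟩

def Good (c : ℕ → ℝ) (n : ℕ → ℕ) (L₁ L₂ : List ℕ → ℝ) (s t : ℝ) (q : List ℕ × List ℕ) : Prop :=
  MoranAdm n q.1 ∧ MoranAdm n q.2 ∧ q.1.length = q.2.length ∧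
  ∃ x ∈ Set.Icc (L₁ q.1) (L₁ q.1 + moranLen c q.1.length),
  ∃ y ∈ Set.Icc (L₂ q.2) (L₂ q.2 + moranLen c q.2.length), t = x + s * y

/-- If `x + s y = t` with `y` in an interval of length `l`, then one can move `x` in
an interval of length `|s| l`. -/
lemma window (s : ℝ) (hs : s ≠ 0) (t b l y : ℝ) (hy : y ∈ Set.Icc b (b + l)) :
    ∃ u v, v - u = |s| * l ∧ u ≤ t - s * y ∧ t - s * y ≤ v ∧
      ∀ x, u ≤ x → x ≤ v → ∃ y' ∈ Set.Icc b (b + l), t = x + s * y' := by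
  obtain ⟨h1, h2⟩ := hy
  rcases lt_or_gt_of_ne hs with h | h
  · refine ⟨t - s * b, t - s * (b + l), by rw [abs_of_neg h]; ring, by nlinarith, by nlinarith,
      fun x hx1 hx2 => ⟨(t - x) / s, ⟨?_, ?_⟩, by field_simp; ring⟩⟩
    · rw [le_div_iff_of_neg h]; linarith
    · rw [div_le_iff_of_neg h]; linarith
  · refine ⟨t - s * (b + l), t - s * b, by rw [abs_of_pos h]; ring, by nlinarith, by nlinarith,
      fun x hx1 hx2 => ⟨(t - x) / s, ⟨?_, ?_⟩, by field_simp; ring⟩⟩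
    · rw [le_div_iff₀ h]; linarith
    · rw [div_le_iff₀ h]; linarith

lemma good_step (c : ℕ → ℝ) (n : ℕ → ℕ) (κ : ℝ)
    (hc : ∀ k ≥ 1, 0 < c k ∧ c k < 1 / 2) (hn : ∀ k ≥ 1, 2 ≤ n k)
    (L₁ L₂ : List ℕ → ℝ) (E₁ E₂ : Set ℝ)
    (hE₁ : IsMoran c n κ L₁ E₁) (hE₂ : IsMoran c n κ L₂ E₂)
    (s : ℝ) (hs : s ≠ 0)
    (hlow : ∀ k ≥ 1, 1 - xiM c n κ k ≤ |s|)
    (hhigh : ∀ k ≥ 1, |s| ≤ c k / (1 - xiM c n κ k)) (t : ℝ) (q : List ℕ × List ℕ)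
    (hq : Good c n L₁ L₂ s t q) :
    ∃ ij : ℕ × ℕ, Good c n L₁ L₂ s t (q.1 ++ [ij.1], q.2 ++ [ij.2]) := by
  obtain ⟨w, v⟩ := q
  obtain ⟨hw, hv, hl, x, hx, y, hy, ht⟩ := hq
  simp only at hw hv hl hx hy
  have hl0 := len_pos c hc w.length
  have hl1 := len_pos c hc (w.length + 1)
  have hsp : 0 < |s| := abs_pos.mpr hs
  have hxi : 0 < 1 - xiM c n κ (w.length + 1) := by
    by_contra hcon
    have h1 := hhigh (w.length + 1) (by omega)
    have h2 := div_nonpos_of_nonneg_of_nonpos (hc (w.length + 1) (by omega)).1.le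
      (not_lt.mp hcon)
    linarith
  have hh : |s| * (1 - xiM c n κ (w.length + 1)) ≤ c (w.length + 1) :=
    (le_div_iff₀ hxi).mp (hhigh _ (by omega))
  obtain ⟨u₁, v₁, e₁, a₁, b₁, k₁⟩ := window s hs t _ _ y hy
  have ex : t - s * y = x := by linarith
  rw [ex] at a₁ b₁
  obtain ⟨i, hi, x', hx', hux, hxv⟩ := hit_child c n κ hn L₁ E₁ hE₁ w hw u₁ v₁ x a₁ b₁ hx hl1 (by
    rw [e₁, ← hl, mul_comm]
    exact mul_le_mul_of_nonneg_right (hlow _ (by omega)) hl0.le)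
  obtain ⟨y', hy', ht'⟩ := k₁ x' hux hxv
  obtain ⟨u₂, v₂, e₂, a₂, b₂, k₂⟩ := window s⁻¹ (inv_ne_zero hs) (s⁻¹ * t) _ _ x' hx'
  have ey : s⁻¹ * t - s⁻¹ * x' = y' := by rw [ht']; field_simp; ring
  rw [ey] at a₂ b₂
  obtain ⟨j, hj, y'', hy'', huy, hyv⟩ := hit_child c n κ hn L₂ E₂ hE₂ v hv u₂ v₂ y' a₂ b₂ hy'
    (hl ▸ hl1) (by
    rw [e₂, ← hl, abs_inv, len_succ, le_inv_mul_iff₀ hsp]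
    nlinarith)
  obtain ⟨x'', hx'', ht''⟩ := k₂ y'' huy hyv
  refine ⟨(i, j), adm_append n w i hw hi, adm_append n v j hv hj, by simp [hl], x'', ?_, y'', ?_, ?_⟩
  · simpa using hx''
  · simpa using hy''
  · field_simp at ht''
    linarith

lemma child_sub (c : ℕ → ℝ) (n : ℕ → ℕ) (κ : ℝ)
    (L : List ℕ → ℝ) (E : Set ℝ) (hE : IsMoran c n κ L E) (hl : ∀ k, 0 < moranLen c k)
    (w : List ℕ) (hw : MoranAdm n w) (i : ℕ) (hi : i < n (w.length + 1)) :
    L w ≤ L (w ++ [i]) ∧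
      L (w ++ [i]) + moranLen c (w.length + 1) ≤ L w + moranLen c w.length := by
  obtain ⟨-, -, -, h⟩ := hE.2.1 w hw
  have hsub : Set.Icc (L (w ++ [i])) (L (w ++ [i]) + moranLen c (w.length + 1)) ⊆
      Set.Icc (L w) (L w + moranLen c w.length) :=
    (Set.subset_biUnion_of_mem (u := fun i => Set.Icc (L (w ++ [i]))
      (L (w ++ [i]) + moranLen c (w.length + 1))) (Finset.mem_range.mpr hi)).trans h.subset
  exact (Set.Icc_subset_Icc_iff (by linarith [hl (w.length + 1)])).mp hsub

/-- Along a nested sequence of words, there is a point of `E` in all intervals. -/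
lemma nested_point (c : ℕ → ℝ) (n : ℕ → ℕ) (κ : ℝ)
    (L : List ℕ → ℝ) (E : Set ℝ) (hE : IsMoran c n κ L E) (hl : ∀ k, 0 < moranLen c k)
    (W : ℕ → List ℕ) (hW : ∀ k, MoranAdm n (W k)) (hlen : ∀ k, (W k).length = k)
    (hnext : ∀ k, ∃ i, W (k + 1) = W k ++ [i]) :
    ∃ x ∈ E, ∀ k, x ∈ Set.Icc (L (W k)) (L (W k) + moranLen c k) := by
  have key : ∀ k, L (W k) ≤ L (W (k + 1)) ∧
      L (W (k + 1)) + moranLen c (k + 1) ≤ L (W k) + moranLen c k := by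
    intro k
    obtain ⟨i, hi⟩ := hnext k
    have h1 := hW (k + 1) k (by simp [hlen])
    rw [hi] at h1
    have h2 : (W k ++ [i]).getD k 0 = i := by
      have := hlen k
      simp [List.getD_eq_getElem?_getD, List.getElem?_append, this]
    rw [h2] at h1
    have := child_sub c n κ L E hE hl (W k) (hW k) i (by rw [hlen]; exact h1)
    rw [hlen, ← hi] at this
    exact this
  have hmono : Monotone fun k => L (W k) := monotone_nat_of_le_succ fun k => (key k).1
  have hanti : Antitone fun k => L (W k) + moranLen c k := antitone_nat_of_succ_le fun k => (key k).2
  have hx := hmono.ciSup_mem_iInter_Icc_of_antitone hanti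
    (fun k => by have := hl k; simp only; linarith)
  refine ⟨_, ?_, fun k => Set.mem_iInter.mp hx k⟩
  rw [hE.2.2]
  refine Set.mem_iInter.mpr fun k => ?_
  exact Set.mem_biUnion (x := W k) ⟨hW k, hlen k⟩ (Set.mem_iInter.mp hx k)

lemma sub_unit (c : ℕ → ℝ) (n : ℕ → ℕ) (κ : ℝ)
    (L : List ℕ → ℝ) (E : Set ℝ) (hE : IsMoran c n κ L E) : E ⊆ Set.Icc 0 1 := by
  intro x hx
  rw [hE.2.2] at hx
  have h0 := Set.mem_iInter.mp hx 0
  simp only [moranLevel, Set.mem_iUnion, Set.mem_setOf_eq] at h0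
  obtain ⟨w, ⟨-, hw⟩, h⟩ := h0
  have : w = [] := List.length_eq_zero_iff.mp hw
  subst this
  rw [hE.1] at h
  simpa [moranLen] using h

lemma image_eq (c : ℕ → ℝ) (n : ℕ → ℕ) (κ : ℝ)
    (hc : ∀ k ≥ 1, 0 < c k ∧ c k < 1 / 2) (hn : ∀ k ≥ 1, 2 ≤ n k)
    (L₁ L₂ : List ℕ → ℝ) (E₁ E₂ : Set ℝ)
    (hE₁ : IsMoran c n κ L₁ E₁) (hE₂ : IsMoran c n κ L₂ E₂)
    (s : ℝ) (hs : s ≠ 0)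
    (hlow : ∀ k ≥ 1, 1 - xiM c n κ k ≤ |s|)
    (hhigh : ∀ k ≥ 1, |s| ≤ c k / (1 - xiM c n κ k)) :
    Set.image2 (fun x y => x + s * y) E₁ E₂ =
      Set.image2 (fun x y => x + s * y) (Set.Icc 0 1) (Set.Icc 0 1) := by
  apply subset_antisymm
  · exact Set.image2_subset (sub_unit c n κ L₁ E₁ hE₁) (sub_unit c n κ L₂ E₂ hE₂)
  rintro t ⟨x, hx, y, hy, ht⟩
  have hl := len_pos c hc
  have g0 : Good c n L₁ L₂ s t ([], []) := by
    refine ⟨fun i hi => by simp at hi, fun i hi => by simp at hi, rfl, x, ?_, y, ?_, ht.symm⟩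
    · simpa [hE₁.1, moranLen] using hx
    · simpa [hE₂.1, moranLen] using hy
  choose f hf using good_step c n κ hc hn L₁ L₂ E₁ E₂ hE₁ hE₂ s hs hlow hhigh t
  let Q : ℕ → {q // Good c n L₁ L₂ s t q} := fun k =>
    Nat.rec ⟨([], []), g0⟩ (fun _ q => ⟨_, hf q.1 q.2⟩) k
  have hQ : ∀ k, (Q (k + 1)).1 = ((Q k).1.1 ++ [(f (Q k).1 (Q k).2).1],
      (Q k).1.2 ++ [(f (Q k).1 (Q k).2).2]) := fun k => rfl
  have hlen1 : ∀ k, (Q k).1.1.length = k := by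
    intro k
    induction k with
    | zero => rfl
    | succ k ih => rw [hQ]; simp [ih]
  have hlen2 : ∀ k, (Q k).1.2.length = k := fun k => (Q k).2.2.2.1 ▸ hlen1 k
  obtain ⟨a, ha, ha'⟩ := nested_point c n κ L₁ E₁ hE₁ hl (fun k => (Q k).1.1)
    (fun k => (Q k).2.1) hlen1 (fun k => ⟨_, congrArg Prod.fst (hQ k)⟩)
  obtain ⟨b, hb, hb'⟩ := nested_point c n κ L₂ E₂ hE₂ hl (fun k => (Q k).1.2)
    (fun k => (Q k).2.2.1) hlen2 (fun k => ⟨_, congrArg Prod.snd (hQ k)⟩)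
  refine ⟨a, ha, b, hb, ?_⟩
  have bound : ∀ k, |a + s * b - t| ≤ (1 + |s|) * (1 / 2) ^ k := by
    intro k
    obtain ⟨-, -, -, x, hx, y, hy, ht⟩ := (Q k).2
    rw [hlen1] at hx
    rw [hlen2] at hy
    have h1 : |a - x| ≤ moranLen c k := by
      have := ha' k
      rw [abs_le]; constructor <;> linarith [this.1, this.2, hx.1, hx.2]
    have h2 : |b - y| ≤ moranLen c k := by
      have := hb' k
      rw [abs_le]; constructor <;> linarith [this.1, this.2, hy.1, hy.2]
    calc |a + s * b - t| = |(a - x) + s * (b - y)| := by rw [ht]; ring_nf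
      _ ≤ |a - x| + |s| * |b - y| := by rw [← abs_mul]; exact abs_add_le _ _
      _ ≤ moranLen c k + |s| * moranLen c k := by gcongr
      _ = (1 + |s|) * moranLen c k := by ring
      _ ≤ _ := mul_le_mul_of_nonneg_left (len_le c hc k) (by positivity)
  have lim : Filter.Tendsto (fun k : ℕ => (1 + |s|) * (1 / 2 : ℝ) ^ k) Filter.atTop (nhds 0) := by
    simpa using (tendsto_pow_atTop_nhds_zero_of_lt_one (r := (1 / 2 : ℝ)) (by norm_num)
      (by norm_num)).const_mul (1 + |s|)
  have h0 : |a + s * b - t| ≤ 0 := ge_of_tendsto' lim bound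
  have := abs_nonpos_iff.mp h0
  simp only
  linarith

theorem stmt_6 (c : ℕ → ℝ) (n : ℕ → ℕ) (κ : ℝ)
    (hc : ∀ k ≥ 1, 0 < c k ∧ c k < 1 / 2) (hn : ∀ k ≥ 1, 2 ≤ n k)
    (hcn : ∀ k ≥ 1, c k * n k < 1) (hκ0 : 0 ≤ κ) (hκ1 : κ < 1)
    (L₁ L₂ : List ℕ → ℝ) (E₁ E₂ : Set ℝ)
    (hE₁ : IsMoran c n κ L₁ E₁) (hE₂ : IsMoran c n κ L₂ E₂)
    (s : ℝ) (hs : s ≠ 0)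
    (hlow : ∀ k ≥ 1, 1 - xiM c n κ k ≤ |s|)
    (hhigh : ∀ k ≥ 1, |s| ≤ c k / (1 - xiM c n κ k)) :
    ∃ a b : ℝ, a ≤ b ∧ Set.image2 (fun x y => x + s * y) E₁ E₂ = Set.Icc a b := by
  rw [image_eq c n κ hc hn L₁ L₂ E₁ E₂ hE₁ hE₂ s hs hlow hhigh]
  have hcomp : IsCompact (Set.image2 (fun x y : ℝ => x + s * y) (Set.Icc 0 1) (Set.Icc 0 1)) := by
    rw [← Set.image_prod]
    exact (isCompact_Icc.prod isCompact_Icc).image (by fun_prop)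
  have hconn : IsConnected (Set.image2 (fun x y : ℝ => x + s * y) (Set.Icc 0 1) (Set.Icc 0 1)) := by
    rw [← Set.image_prod]
    exact ((isConnected_Icc zero_le_one).prod (isConnected_Icc zero_le_one)).image _
      (by fun_prop)
  have h := eq_Icc_of_connected_compact hconn hcomp
  refine ⟨_, _, ?_, h⟩
  have h2 := hconn.nonempty
  rw [h] at h2
  exact Set.nonempty_Icc.mp h2
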